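/- Let ν be a probability measure on ℝ, let I be an open interval of ℝ, and suppose there exist an open set Ω ⊆ ℂ containing {z : Im z < 0} ∪ I and an analytic function g on Ω such that g(z) = G_ν(z) for all z with Im z < 0. Then the restriction of ν to I is absolutely continuous with respect to Lebesgue measure, with (analytic) density x ↦ (1/π)·Im g(x) for x ∈ I. -/

import Mathlib

open MeasureTheory Complex Real

/-- Cauchy transform of a measure on `ℝ`. -/
noncomputable def cauchyT (ν : Measure ℝ) (z : ℂ) : ℂ := ∫ x : ℝ, (z - (x:ℂ))⁻¹ ∂ν

open Filter Topology Set

/-- The imaginary part of the Cauchy transform on a horizontal line is a Poisson integral. -/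
lemma im_cauchyT_sub_mul_I (ν : Measure ℝ) [IsFiniteMeasure ν] (x : ℝ) {ε : ℝ} (hε : 0 < ε) :
    (cauchyT ν (x - ε * Complex.I)).im = ∫ t : ℝ, ε / (ε ^ 2 + (x - t) ^ 2) ∂ν := by
  have hint : Integrable (fun t : ℝ ↦ ((x - ε * Complex.I : ℂ) - (t : ℂ))⁻¹) ν := by
    refine Integrable.of_bound (C := ε⁻¹) (by fun_prop) (ae_of_all _ fun t ↦ ?_)
    rw [norm_inv]
    refine inv_anti₀ hε ?_
    simpa [abs_of_pos hε] using Complex.abs_im_le_norm ((x - ε * Complex.I : ℂ) - (t : ℂ))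
  have h := integral_im hint
  simp only [RCLike.im_eq_complex_im] at h
  rw [cauchyT, ← h]
  refine integral_congr_ae (ae_of_all _ fun t ↦ ?_)
  simp [Complex.inv_im, Complex.normSq_apply]
  ring

lemma integral_im_cauchyT_sub_mul_I (ν : Measure ℝ) [IsFiniteMeasure ν] (a b : ℝ) {ε : ℝ}
    (hε : 0 < ε) :
    ∫ x in a..b, (cauchyT ν (x - ε * Complex.I)).im =
      ∫ t : ℝ, (Real.arctan ((b - t) / ε) - Real.arctan ((a - t) / ε)) ∂ν := by
  simp_rw [im_cauchyT_sub_mul_I ν _ hε]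
  rw [intervalIntegral_integral_swap]
  · refine integral_congr_ae (ae_of_all _ fun t ↦ ?_)
    simp only
    rw [intervalIntegral.integral_comp_sub_right (fun x ↦ ε / (ε ^ 2 + x ^ 2)),
      integral_div_sq_add_sq]
  · have : IsFiniteMeasure (volume.restrict (Set.uIoc a b)) := by
      rw [Set.uIoc]; infer_instance
    refine Integrable.of_bound (C := ε⁻¹) ?_ (ae_of_all _ fun p ↦ ?_)
    · apply Continuous.aestronglyMeasurable
      unfold Function.uncurry
      fun_prop (disch := intros; positivity)
    · simp only [Function.uncurry]
      rw [Real.norm_of_nonneg (by positivity), inv_eq_one_div, div_le_div_iff₀ (by positivity) hε]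
      nlinarith [sq_nonneg (p.1 - p.2)]

lemma tendsto_arctan_div_nhdsGT_zero (y : ℝ) :
    Tendsto (fun ε : ℝ ↦ Real.arctan (y / ε)) (𝓝[>] 0) (𝓝 (π / 2 * Real.sign y)) := by
  rcases lt_trichotomy y 0 with hy | rfl | hy
  · rw [Real.sign_of_neg hy, mul_neg_one]
    exact (tendsto_nhds_of_tendsto_nhdsWithin tendsto_arctan_atBot).comp
      (tendsto_inv_nhdsGT_zero.const_mul_atTop_of_neg hy)
  · simp
  · rw [Real.sign_of_pos hy, mul_one]
    exact (tendsto_nhds_of_tendsto_nhdsWithin tendsto_arctan_atTop).comp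
      (tendsto_inv_nhdsGT_zero.const_mul_atTop hy)

lemma sign_sub_sub_sign_sub {a b : ℝ} (hab : a < b) (t : ℝ) :
    Real.sign (b - t) - Real.sign (a - t) =
      (Ioo a b).indicator 1 t + (Icc a b).indicator 1 t := by
  simp only [Real.sign, indicator_apply, mem_Ioo, mem_Icc, Pi.one_apply, sub_neg, sub_pos]
  split_ifs <;> grind

/-- Stieltjes inversion formula on an interval. -/
lemma tendsto_integral_im_cauchyT (ν : Measure ℝ) [IsFiniteMeasure ν] {a b : ℝ} (hab : a < b) :
    Tendsto (fun ε : ℝ ↦ ∫ x in a..b, (cauchyT ν (x - ε * Complex.I)).im) (𝓝[>] 0)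
      (𝓝 (π / 2 * (ν.real (Ioo a b) + ν.real (Icc a b)))) := by
  have hval : π / 2 * (ν.real (Ioo a b) + ν.real (Icc a b)) =
      ∫ t : ℝ, (π / 2 * Real.sign (b - t) - π / 2 * Real.sign (a - t)) ∂ν := by
    simp_rw [← mul_sub, sign_sub_sub_sign_sub hab]
    rw [integral_const_mul, integral_add, integral_indicator_one measurableSet_Ioo,
      integral_indicator_one measurableSet_Icc]
    · exact (integrable_const (1 : ℝ)).indicator measurableSet_Ioo
    · exact (integrable_const (1 : ℝ)).indicator measurableSet_Icc
  rw [hval]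
  have hlim : Tendsto (fun ε : ℝ ↦ ∫ t : ℝ, (Real.arctan ((b - t) / ε) - Real.arctan ((a - t) / ε)) ∂ν)
      (𝓝[>] 0) (𝓝 (∫ t : ℝ, (π / 2 * Real.sign (b - t) - π / 2 * Real.sign (a - t)) ∂ν)) := by
    refine tendsto_integral_filter_of_dominated_convergence (fun _ ↦ π)
      (Eventually.of_forall fun ε ↦ ?_) (Eventually.of_forall fun ε ↦ ae_of_all _ fun t ↦ ?_)
      (integrable_const _) (ae_of_all _ fun t ↦
        (tendsto_arctan_div_nhdsGT_zero _).sub (tendsto_arctan_div_nhdsGT_zero _))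
    · apply Measurable.aestronglyMeasurable
      fun_prop
    · rw [Real.norm_eq_abs, abs_le]
      constructor <;>
      linarith [arctan_lt_pi_div_two ((b - t) / ε), neg_pi_div_two_lt_arctan ((b - t) / ε),
        arctan_lt_pi_div_two ((a - t) / ε), neg_pi_div_two_lt_arctan ((a - t) / ε)]
  refine hlim.congr' ?_
  filter_upwards [self_mem_nhdsWithin] with ε hε
  exact (integral_im_cauchyT_sub_mul_I ν a b hε).symm

/-- Convergence of integrals over horizontal segments approaching the real axis from below. -/
lemma tendsto_integral_im_of_continuousOn {g : ℂ → ℂ} {a b : ℝ} (hab : a ≤ b)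
    (hg : ContinuousOn g (Icc a b ×ℂ Icc (-1) 0)) :
    Tendsto (fun ε : ℝ ↦ ∫ x in a..b, (g (x - ε * Complex.I)).im) (𝓝[>] 0)
      (𝓝 (∫ x in a..b, (g x).im)) := by
  obtain ⟨C, hC⟩ := (isCompact_Icc.reProdIm isCompact_Icc).exists_bound_of_continuousOn hg
  have hmem : ∀ x ∈ Icc a b, ∀ ε ∈ Icc (0 : ℝ) 1,
      (x - ε * Complex.I : ℂ) ∈ Icc a b ×ℂ Icc (-1) 0 := by
    intro x hx ε hε
    simpa [Complex.mem_reProdIm] using ⟨hx, hε.2, hε.1⟩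
  have hev : ∀ᶠ ε : ℝ in 𝓝[>] 0, ε ∈ Icc (0 : ℝ) 1 :=
    mem_of_superset (Ioc_mem_nhdsGT one_pos) Ioc_subset_Icc_self
  refine intervalIntegral.tendsto_integral_filter_of_dominated_convergence (fun _ ↦ C)
    ?_ ?_ (by simp) ?_
  · filter_upwards [hev] with ε hε
    rw [uIoc_of_le hab]
    refine (ContinuousOn.aestronglyMeasurable ?_ measurableSet_Icc).mono_set Ioc_subset_Icc_self
    exact Complex.continuous_im.comp_continuousOn
      (hg.comp (by fun_prop) fun x hx ↦ hmem x hx ε hε)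
  · filter_upwards [hev] with ε hε
    refine ae_of_all _ fun x hx ↦ ?_
    rw [uIoc_of_le hab] at hx
    exact (Complex.abs_im_le_norm _).trans (hC _ (hmem x (Ioc_subset_Icc_self hx) ε hε))
  · refine ae_of_all _ fun x hx ↦ ?_
    rw [uIoc_of_le hab] at hx
    have hx := Ioc_subset_Icc_self hx
    have h0 := hmem x hx 0 (by simp)
    simp only [Complex.ofReal_zero, zero_mul, sub_zero] at h0
    refine (Complex.continuous_im.tendsto _).comp ((hg _ h0).tendsto.comp ?_)
    refine tendsto_nhdsWithin_iff.2 ⟨?_, hev.mono fun ε hε ↦ hmem x hx ε hε⟩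
    have : Continuous fun ε : ℝ ↦ (x - ε * Complex.I : ℂ) := by fun_prop
    simpa using (this.tendsto 0).mono_left nhdsWithin_le_nhds

lemma Real.exists_rat_mem_Ioo_Icc_subset {U : Set ℝ} (hU : IsOpen U) {x : ℝ} (hx : x ∈ U) :
    ∃ p q : ℚ, x ∈ Ioo (p : ℝ) q ∧ Icc (p : ℝ) q ⊆ U := by
  obtain ⟨δ, hδ, hball⟩ := Metric.isOpen_iff.1 hU x hx
  obtain ⟨p, hp, hpx⟩ := exists_rat_btwn (sub_lt_self x hδ)
  obtain ⟨q, hxq, hq⟩ := exists_rat_btwn (lt_add_of_pos_right x hδ)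
  refine ⟨p, q, ⟨hpx, hxq⟩, fun y hy ↦ hball ?_⟩
  rw [Real.ball_eq_Ioo]
  exact ⟨hp.trans_le hy.1, hy.2.trans_lt hq⟩

/-- Two measures that agree on the half-open intervals whose closure lies in an open set `U`,
one of them being finite, agree on `U`. -/
lemma MeasureTheory.Measure.restrict_eq_of_Ioc {μ ν : Measure ℝ} {U : Set ℝ} (hU : IsOpen U)
    [IsFiniteMeasure ν]
    (h : ∀ a b, a < b → Icc a b ⊆ U → ν (Ioc a b) = μ (Ioc a b)) :
    ν.restrict U = μ.restrict U := by
  let S : Set (ℚ × ℚ) := {p | Icc (p.1 : ℝ) p.2 ⊆ U}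
  have hUS : U = ⋃ p ∈ S, Ioc (p.1 : ℝ) p.2 := by
    refine Subset.antisymm (fun x hx ↦ ?_)
      (iUnion₂_subset fun p hp ↦ Ioc_subset_Icc_self.trans hp)
    obtain ⟨p, q, hmem, hsub⟩ := Real.exists_rat_mem_Ioo_Icc_subset hU hx
    exact mem_iUnion₂.2 ⟨(p, q), hsub, Ioo_subset_Ioc_self hmem⟩
  rw [hUS, Measure.restrict_biUnion_congr S.to_countable]
  intro p hp
  refine Measure.ext_of_Ioc _ _ fun c d _ ↦ ?_
  rw [Measure.restrict_apply measurableSet_Ioc, Measure.restrict_apply measurableSet_Ioc,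
    Ioc_inter_Ioc]
  rcases lt_or_ge (c ⊔ p.1) (d ⊓ p.2) with hlt | hge
  · exact h _ _ hlt ((Icc_subset_Icc le_sup_right inf_le_right).trans hp)
  · simp [Ioc_eq_empty_of_le hge]

/-- If averages of open and closed interval masses are given by integrating a continuous function,
then there are no atoms. -/
lemma measure_singleton_eq_zero_of_integral {ν : Measure ℝ} [IsFiniteMeasure ν] {U : Set ℝ}
    (hU : IsOpen U) {f : ℝ → ℝ} (hf : ContinuousOn f U)
    (h : ∀ a b, a < b → Icc a b ⊆ U →
      (ν.real (Ioo a b) + ν.real (Icc a b)) / 2 = ∫ x in a..b, f x) {x : ℝ} (hx : x ∈ U) :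
    ν.real {x} = 0 := by
  obtain ⟨p, q, hmem, hsub⟩ := Real.exists_rat_mem_Ioo_Icc_subset hU hx
  have hpq : (p : ℝ) < q := hmem.1.trans hmem.2
  obtain ⟨C, hC⟩ := isCompact_Icc.exists_bound_of_continuousOn (hf.mono hsub)
  have hev : ∀ᶠ δ : ℝ in 𝓝[>] 0, ν.real {x} ≤ C * (2 * δ) := by
    filter_upwards [Ioo_mem_nhdsGT (lt_min (sub_pos.2 hmem.1) (sub_pos.2 hmem.2))] with δ hδ
    obtain ⟨hδ0, hδ⟩ := hδ
    rw [lt_min_iff] at hδ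
    have hIcc : Icc (x - δ) (x + δ) ⊆ Icc (p : ℝ) q :=
      Icc_subset_Icc (by linarith) (by linarith)
    have heq := h (x - δ) (x + δ) (by linarith) (hIcc.trans hsub)
    have h1 : ν.real {x} ≤ ν.real (Ioo (x - δ) (x + δ)) :=
      measureReal_mono (by simpa using hδ0)
    have h2 : ν.real {x} ≤ ν.real (Icc (x - δ) (x + δ)) :=
      measureReal_mono (by simpa using hδ0.le)
    have h3 : ‖∫ y in (x - δ)..(x + δ), f y‖ ≤ C * |x + δ - (x - δ)| := by
      refine intervalIntegral.norm_integral_le_of_norm_le_const fun y hy ↦ hC y (hIcc ?_)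
      rw [uIoc_of_le (by linarith)] at hy
      exact Ioc_subset_Icc_self hy
    rw [show x + δ - (x - δ) = 2 * δ by ring, abs_of_pos (by linarith)] at h3
    linarith [le_abs_self (∫ y in (x - δ)..(x + δ), f y), Real.norm_eq_abs
      (∫ y in (x - δ)..(x + δ), f y)]
  have hlim : Tendsto (fun δ : ℝ ↦ C * (2 * δ)) (𝓝[>] 0) (𝓝 0) := by
    have : Continuous fun δ : ℝ ↦ C * (2 * δ) := by fun_prop
    simpa using (this.tendsto 0).mono_left nhdsWithin_le_nhds
  exact le_antisymm (ge_of_tendsto hlim hev) measureReal_nonneg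

/-- if the Cauchy transform of a probability measure `ν` on `ℝ`, restricted to
the lower half-plane, extends analytically to an open set containing the lower half-plane
and an open interval `I` of `ℝ`, then the restriction of `ν` to `I` is absolutely continuous
with density `x ↦ (1/π)·Im g(x)`. -/
theorem stmt13 (ν : Measure ℝ) [IsProbabilityMeasure ν]
    (I : Set ℝ) (hIopen : IsOpen I) (hIconn : I.OrdConnected)
    (Ω : Set ℂ) (hΩ : IsOpen Ω)
    (hsub : {z : ℂ | z.im < 0} ∪ (Complex.ofReal '' I) ⊆ Ω)
    (g : ℂ → ℂ) (hg : AnalyticOnNhd ℂ g Ω)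
    (hgG : ∀ z : ℂ, z.im < 0 → g z = cauchyT ν z) :
    ∀ s : Set ℝ, MeasurableSet s → s ⊆ I →
      (ν s).toReal = ∫ x in s, (1 / Real.pi) * (g (x:ℂ)).im := by
  intro s hs hsI
  have hGI : ContinuousOn (fun x : ℝ ↦ (g x).im) I :=
    Complex.continuous_im.comp_continuousOn (hg.continuousOn.comp (by fun_prop)
      fun x hx ↦ hsub (Or.inr ⟨x, hx, rfl⟩))
  have hf : ContinuousOn (fun x : ℝ ↦ (1 / π) * (g x).im) I := hGI.const_mul _
  have hnonneg : ∀ x ∈ I, 0 ≤ (1 / π) * (g x).im := by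
    intro x hx
    have hgx : ContinuousAt g x := (hg x (hsub (Or.inr ⟨x, hx, rfl⟩))).continuousAt
    have hlim : Tendsto (fun ε : ℝ ↦ (g (x - ε * Complex.I)).im) (𝓝[>] 0) (𝓝 (g x).im) := by
      refine (Complex.continuous_im.tendsto _).comp (hgx.tendsto.comp ?_)
      have : Continuous fun ε : ℝ ↦ (x - ε * Complex.I : ℂ) := by fun_prop
      simpa using (this.tendsto 0).mono_left nhdsWithin_le_nhds
    refine mul_nonneg (by positivity) (ge_of_tendsto hlim ?_)
    filter_upwards [self_mem_nhdsWithin] with ε hε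
    have hε : 0 < ε := hε
    rw [hgG _ (by simpa using hε), im_cauchyT_sub_mul_I ν x hε]
    exact integral_nonneg fun t ↦ by positivity
  have havg : ∀ a b, a < b → Icc a b ⊆ I →
      (ν.real (Ioo a b) + ν.real (Icc a b)) / 2 = ∫ x in a..b, (1 / π) * (g x).im := by
    intro a b hab habI
    have hcont : ContinuousOn g (Icc a b ×ℂ Icc (-1) 0) := by
      refine hg.continuousOn.mono fun z hz ↦ hsub ?_
      rcases hz.2.2.lt_or_eq with h | h
      · exact Or.inl h
      · exact Or.inr ⟨z.re, habI hz.1, Complex.ext rfl h.symm⟩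
    have h1 := tendsto_integral_im_of_continuousOn hab.le hcont
    have h2 : Tendsto (fun ε : ℝ ↦ ∫ x in a..b, (g (x - ε * Complex.I)).im) (𝓝[>] 0)
        (𝓝 (π / 2 * (ν.real (Ioo a b) + ν.real (Icc a b)))) := by
      refine (tendsto_integral_im_cauchyT ν hab).congr' ?_
      filter_upwards [self_mem_nhdsWithin] with ε hε
      have hε : 0 < ε := hε
      refine intervalIntegral.integral_congr fun x _ ↦ ?_
      rw [hgG _ (by simpa using hε)]
    rw [intervalIntegral.integral_const_mul, tendsto_nhds_unique h1 h2]
    field_simp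
  have hatom : ∀ x ∈ I, ν {x} = 0 := fun x hx ↦
    (measureReal_eq_zero_iff).1 (measure_singleton_eq_zero_of_integral hIopen hf havg hx)
  have hIoc : ∀ a b, a < b → Icc a b ⊆ I → ν (Ioc a b) =
      (volume.withDensity fun x : ℝ ↦ ENNReal.ofReal ((1 / π) * (g x).im)) (Ioc a b) := by
    intro a b hab habI
    have hIoo : Ioo a b =ᵐ[ν] Ioc a b := Ioo_ae_eq_Ioc' (hatom b (habI ⟨hab.le, le_rfl⟩))
    have hIcc : Ioc a b =ᵐ[ν] Icc a b := Ioc_ae_eq_Icc' (hatom a (habI ⟨le_rfl, hab.le⟩))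
    have h := havg a b hab habI
    rw [measureReal_congr hIoo, ← measureReal_congr hIcc, add_self_div_two,
      intervalIntegral.integral_of_le hab.le] at h
    have hint : IntegrableOn (fun x : ℝ ↦ (1 / π) * (g x).im) (Ioc a b) :=
      (hf.mono habI).integrableOn_Icc.mono_set Ioc_subset_Icc_self
    rw [withDensity_apply _ measurableSet_Ioc, ← ofReal_integral_eq_lintegral_ofReal hint, ← h,
      ofReal_measureReal]
    filter_upwards [ae_restrict_mem measurableSet_Ioc] with x hx
    exact hnonneg x (habI (Ioc_subset_Icc_self hx))
  have hrestrict := Measure.restrict_eq_of_Ioc hIopen hIoc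
  have hνs : ν s = ∫⁻ x in s, ENNReal.ofReal ((1 / π) * (g x).im) := by
    rw [← withDensity_apply _ hs, ← inter_eq_self_of_subset_left hsI,
      ← Measure.restrict_apply hs, ← Measure.restrict_apply hs, hrestrict]
  rw [hνs, integral_eq_lintegral_of_nonneg_ae]
  · filter_upwards [ae_restrict_mem hs] with x hx
    exact hnonneg x (hsI hx)
  · exact (hf.aestronglyMeasurable hIopen.measurableSet).mono_set hsI
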